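/- arXiv:2008.03726 — 5 statements merged into one kernel-verified Lean document; each statement's English description precedes it below -/
import Mathlib

section
/- For every i with 1 ≤ i ≤ n−1 and every natural number m, Σ_{h=0}^{m} [h]_{i−1} a_h = ((𝛂₀)_{i−1}/(𝛃₀)_{i−1})·Σ_{ℓ=0}^{m−i+1} (𝛂₀+i−1)_ℓ/((𝛃₀+i−1)_ℓ·ℓ!), where the sum on the right is empty (equal to 0) when m < i−1. -/
open Finset

/-- The Pochhammer symbol `(a)_m = a(a+1)⋯(a+m−1)`. -/
noncomputable def poch (a : ℂ) (m : ℕ) : ℂ := ∏ s ∈ Finset.range m, (a + s)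

/-- The falling factorial `[h]_j = h(h−1)⋯(h−j+1)`. -/
noncomputable def ffall (h : ℂ) (j : ℕ) : ℂ := ∏ s ∈ Finset.range j, (h - s)

/-- The hypergeometric coefficients
`a_m = ((α₁)_m⋯(αₙ)_m)/((β₁)_m⋯(β_{n−1})_m · m!)` (indices `1,…,n` resp. `1,…,n−1`). -/
noncomputable def aCoef (n : ℕ) (α β : ℕ → ℂ) (m : ℕ) : ℂ :=
  (∏ i ∈ Finset.Icc 1 n, poch (α i) m) /
    ((∏ j ∈ Finset.Icc 1 (n - 1), poch (β j) m) * (Nat.factorial m : ℂ))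

theorem poch_add (a : ℂ) (k l : ℕ) : poch a (k + l) = poch a k * poch (a + k) l := by
  simp only [poch, Finset.prod_range_add, Nat.cast_add, add_assoc]

theorem ffall_eq_zero_of_lt {h k : ℕ} (hk : h < k) : ffall (h : ℂ) k = 0 :=
  Finset.prod_eq_zero (Finset.mem_range.mpr hk) (sub_self _)

theorem ffall_add_mul_factorial (k l : ℕ) :
    ffall ((k + l : ℕ) : ℂ) k * (l.factorial : ℂ) = ((k + l).factorial : ℂ) := by
  induction k with
  | zero => simp [ffall]
  | succ k ih =>
    have hshift : ffall ((k + 1 + l : ℕ) : ℂ) (k + 1) =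
        ((k + l + 1 : ℕ) : ℂ) * ffall ((k + l : ℕ) : ℂ) k := by
      simp only [ffall]
      rw [Finset.prod_range_succ', mul_comm]
      congr 1
      · push_cast
        ring
      · refine Finset.prod_congr rfl fun s _ => ?_
        push_cast
        ring
    rw [hshift, mul_assoc, ih, Nat.add_right_comm k 1 l, Nat.factorial_succ, Nat.cast_mul]

theorem ffall_mul_aCoef_add (n : ℕ) (α β : ℕ → ℂ) (k l : ℕ) :
    ffall ((k + l : ℕ) : ℂ) k * aCoef n α β (k + l) =
      ((∏ i ∈ Finset.Icc 1 n, poch (α i) k) / ∏ j ∈ Finset.Icc 1 (n - 1), poch (β j) k) *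
        ((∏ i ∈ Finset.Icc 1 n, poch (α i + k) l) /
          ((∏ j ∈ Finset.Icc 1 (n - 1), poch (β j + k) l) * (l.factorial : ℂ))) := by
  have hfac := ffall_add_mul_factorial k l
  have hne : ffall ((k + l : ℕ) : ℂ) k ≠ 0 := by
    intro h0
    rw [h0, zero_mul] at hfac
    exact Nat.cast_ne_zero.mpr (Nat.factorial_ne_zero _) hfac.symm
  simp only [aCoef, poch_add, Finset.prod_mul_distrib]
  rw [← hfac, ← mul_div_assoc, div_mul_div_comm]
  conv_rhs => rw [← mul_div_mul_left _ _ hne]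
  congr 1
  ring

/-- for `1 ≤ i ≤ n−1` and any natural `m`,
`Σ_{h=0}^{m} [h]_{i−1} a_h = ((𝛂₀)_{i−1}/(𝛃₀)_{i−1})·Σ_{ℓ=0}^{m−i+1} (𝛂₀+i−1)_ℓ/((𝛃₀+i−1)_ℓ·ℓ!)`,
where the right-hand sum is empty when `m < i−1` (the range `Finset.range (m+2-i)`
is empty exactly in that case). -/
theorem falling_factorial_sum_shift (n : ℕ) (hn : 2 ≤ n) (α β : ℕ → ℂ)
    (hβ : ∀ j ∈ Finset.Icc 1 (n - 1), ∀ k : ℕ, β j ≠ -(k : ℂ))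
    (i : ℕ) (hi1 : 1 ≤ i) (hi2 : i ≤ n - 1) (m : ℕ) :
    ∑ h ∈ Finset.range (m + 1), ffall (h : ℂ) (i - 1) * aCoef n α β h =
      ((∏ i' ∈ Finset.Icc 1 n, poch (α i') (i - 1)) /
          ∏ j ∈ Finset.Icc 1 (n - 1), poch (β j) (i - 1)) *
        ∑ ℓ ∈ Finset.range (m + 2 - i),
          (∏ i' ∈ Finset.Icc 1 n, poch (α i' + (i - 1 : ℕ)) ℓ) /
            ((∏ j ∈ Finset.Icc 1 (n - 1), poch (β j + (i - 1 : ℕ)) ℓ) *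
              (Nat.factorial ℓ : ℂ)) := by
  obtain ⟨k, rfl⟩ := Nat.exists_eq_add_of_le' hi1
  simp only [Nat.add_sub_cancel, Nat.reduceSubDiff]
  rcases le_total (m + 1) k with hmk | hkm
  · rw [Nat.sub_eq_zero_of_le hmk, Finset.sum_range_zero, mul_zero]
    refine Finset.sum_eq_zero fun h hh => ?_
    rw [ffall_eq_zero_of_lt ((Finset.mem_range.mp hh).trans_le hmk), zero_mul]
  · obtain ⟨r, hr⟩ := Nat.exists_eq_add_of_le hkm
    rw [hr, Nat.add_sub_cancel_left, Finset.sum_range_add, Finset.mul_sum,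
      Finset.sum_eq_zero fun h hh => by
        rw [ffall_eq_zero_of_lt (Finset.mem_range.mp hh), zero_mul], zero_add]
    exact Finset.sum_congr rfl fun l _ => ffall_mul_aCoef_add n α β k l
end

section
/- Let n ≥ 1 and let α₁,…,αₙ, β₁,…,βₙ be complex numbers with α₁+⋯+αₙ = β₁+⋯+βₙ. Then lim_{m→∞} (Γ(α₁+m)Γ(α₂+m)⋯Γ(αₙ+m))/(Γ(β₁+m)Γ(β₂+m)⋯Γ(βₙ+m)) = 1, where m ranges over natural numbers (large enough that no argument is a pole of Γ). -/
open Finset Filter Topology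

/-- The Gauss asymptotic formula for `Γ` along the naturals, away from the poles. -/
theorem Complex.tendsto_Gamma_add_nat_div_of_ne_neg_nat {z : ℂ} (hz : ∀ k : ℕ, z ≠ -k) :
    Tendsto (fun m : ℕ => Complex.Gamma (z + (m + 1)) / ((m : ℂ) ^ z * m.factorial))
      atTop (𝓝 1) := by
  have hΓ := Complex.Gamma_ne_zero hz
  have hprod (m : ℕ) :
      Complex.Gamma (z + m) = Complex.Gamma z * ∏ j ∈ Finset.range m, (z + j) := by
    induction m with
    | zero => simp
    | succ m ih =>
      rw [Finset.prod_range_succ, ← mul_assoc, ← ih, Nat.cast_succ, ← add_assoc,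
        Complex.Gamma_add_one _ (by simpa [add_eq_zero_iff_eq_neg] using hz m), mul_comm]
  have hlim := (Complex.GammaSeq_tendsto_Gamma z).inv₀ hΓ |>.const_mul (Complex.Gamma z)
  rw [mul_inv_cancel₀ hΓ] at hlim
  refine hlim.congr fun m => ?_
  rw [Complex.GammaSeq, inv_div, ← mul_div_assoc, ← hprod, Nat.cast_succ]

/-- The Gauss asymptotic formula for `Γ` along the naturals. -/
theorem Complex.tendsto_Gamma_add_nat_div (z : ℂ) :
    Tendsto (fun m : ℕ => Complex.Gamma (z + (m + 1)) / ((m : ℂ) ^ z * m.factorial))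
      atTop (𝓝 1) := by
  by_cases hz : ∀ k : ℕ, z ≠ -k
  · exact Complex.tendsto_Gamma_add_nat_div_of_ne_neg_nat hz
  push Not at hz
  obtain ⟨k, rfl⟩ := hz
  induction k with
  | zero =>
    refine tendsto_const_nhds.congr fun m => ?_
    simp [Complex.Gamma_nat_eq_factorial, Nat.factorial_ne_zero]
  | succ k ih =>
    have hlim := ih.mul (tendsto_natCast_div_add_atTop (-(k : ℂ)))
    rw [mul_one] at hlim
    refine hlim.congr' ?_
    filter_upwards [eventually_gt_atTop k] with m hm
    have hm0 : (m : ℂ) ≠ 0 := Nat.cast_ne_zero.mpr (by lia)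
    have hmk : (m : ℂ) + -(k : ℂ) ≠ 0 := by
      rw [← sub_eq_add_neg, sub_ne_zero]
      exact_mod_cast hm.ne'
    have hfac : (m.factorial : ℂ) ≠ 0 := Nat.cast_ne_zero.mpr m.factorial_ne_zero
    have hpow : (m : ℂ) ^ (-(k : ℂ)) = (m : ℂ) ^ (-((k + 1 : ℕ) : ℂ)) * m := by
      rw [← sub_add_cancel (-(k : ℂ)) 1, Complex.cpow_add _ _ hm0, Complex.cpow_one]
      push_cast
      ring_nf
    have hpow0 : (m : ℂ) ^ (-((k + 1 : ℕ) : ℂ)) ≠ 0 := by simp [Complex.cpow_eq_zero_iff, hm0]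
    have hrec : Complex.Gamma (-(k : ℂ) + (m + 1)) = (m + -(k : ℂ)) *
        Complex.Gamma (-((k + 1 : ℕ) : ℂ) + (m + 1)) := by
      have harg : -((k + 1 : ℕ) : ℂ) + (m + 1) = m + -(k : ℂ) := by
        push_cast
        ring
      rw [harg, ← Complex.Gamma_add_one _ hmk]
      ring_nf
    rw [hrec, hpow]
    field_simp

/-- A product of powers of a fixed nonzero base is the power to the sum of the exponents. -/
theorem Complex.prod_cpow_eq_cpow_sum {ι : Type*} {x : ℂ} (hx : x ≠ 0) (s : Finset ι)
    (f : ι → ℂ) : ∏ i ∈ s, x ^ f i = x ^ ∑ i ∈ s, f i := by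
  simp only [Complex.cpow_def_of_ne_zero hx, Finset.mul_sum, Complex.exp_sum]

/-- if `α₁+⋯+αₙ = β₁+⋯+βₙ` then
`Γ(α₁+m)⋯Γ(αₙ+m) / (Γ(β₁+m)⋯Γ(βₙ+m)) → 1` as `m → ∞` along the naturals. -/
theorem gamma_ratio_tendsto_one (n : ℕ) (hn : 1 ≤ n) (α β : ℕ → ℂ)
    (hsum : ∑ i ∈ Finset.Icc 1 n, α i = ∑ i ∈ Finset.Icc 1 n, β i) :
    Filter.Tendsto
      (fun m : ℕ =>
        (∏ i ∈ Finset.Icc 1 n, Complex.Gamma (α i + m)) /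
          ∏ i ∈ Finset.Icc 1 n, Complex.Gamma (β i + m))
      Filter.atTop (nhds 1) := by
  have hlim (γ : ℕ → ℂ) := tendsto_finsetProd (Finset.Icc 1 n)
    fun i _ => Complex.tendsto_Gamma_add_nat_div (γ i)
  simp only [Finset.prod_const_one] at hlim
  have hratio := (hlim α).div (hlim β) one_ne_zero
  rw [div_one] at hratio
  rw [← tendsto_add_atTop_iff_nat 1]
  refine hratio.congr' ?_
  filter_upwards [eventually_ne_atTop 0] with m hm
  have hm0 : (m : ℂ) ≠ 0 := Nat.cast_ne_zero.mpr hm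
  have hfac : (m.factorial : ℂ) ≠ 0 := Nat.cast_ne_zero.mpr m.factorial_ne_zero
  have hden : (m : ℂ) ^ (∑ i ∈ Finset.Icc 1 n, β i) *
      ∏ _i ∈ Finset.Icc 1 n, (m.factorial : ℂ) ≠ 0 :=
    mul_ne_zero (by simp [Complex.cpow_eq_zero_iff, hm0])
      (Finset.prod_ne_zero_iff.mpr fun _ _ => hfac)
  simp only [Pi.div_apply, Finset.prod_div_distrib, Finset.prod_mul_distrib,
    Complex.prod_cpow_eq_cpow_sum hm0, hsum, Nat.cast_succ]
  rw [div_div_div_cancel_right₀ hden]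
end

section
/- Assume in addition that none of α₁,…,αₙ and βₙ is a nonpositive integer. Then lim_{m→∞} (Γ(βₙ)Γ(m+1)/Γ(m+βₙ))·a_m = Γ(β₁)⋯Γ(β_{n−1})Γ(βₙ)/(Γ(α₁)⋯Γ(αₙ)), where m ranges over natural numbers. -/
open Finset Filter Topology

theorem poch_ne_zero {s : ℂ} (hs : ∀ k : ℕ, s ≠ -(k : ℂ)) (m : ℕ) : poch s m ≠ 0 :=
  Finset.prod_ne_zero_iff.2 fun k _ h => hs k (eq_neg_of_add_eq_zero_left h)

theorem Gamma_add_natCast_eq_poch_mul {s : ℂ} (hs : ∀ k : ℕ, s ≠ -(k : ℂ)) (m : ℕ) :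
    Complex.Gamma ((m : ℂ) + s) = poch s m * Complex.Gamma s := by
  induction m with
  | zero => simp [poch]
  | succ m ih =>
    have hne : (m : ℂ) + s ≠ 0 := fun h => hs m (eq_neg_of_add_eq_zero_right h)
    have hp : poch s (m + 1) = poch s m * (s + m) := Finset.prod_range_succ _ _
    have hc : ((m + 1 : ℕ) : ℂ) + s = (m + s) + 1 := by push_cast; ring
    rw [hc, Complex.Gamma_add_one _ hne, ih, hp]
    ring

/-- The Pochhammer symbol divided by its growth rate `m ^ s * (m - 1)!`. -/
noncomputable def normalizedPoch (s : ℂ) (m : ℕ) : ℂ :=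
  poch s m / ((m : ℂ) ^ s * ((Nat.factorial m : ℂ) / m))

theorem poch_eq_normalizedPoch_mul (s : ℂ) {m : ℕ} (hm : m ≠ 0) :
    poch s m = normalizedPoch s m * ((m : ℂ) ^ s * ((Nat.factorial m : ℂ) / m)) := by
  have hm' : (m : ℂ) ≠ 0 := Nat.cast_ne_zero.2 hm
  have hf : (Nat.factorial m : ℂ) ≠ 0 := Nat.cast_ne_zero.2 m.factorial_ne_zero
  rw [normalizedPoch, div_mul_cancel₀]
  exact mul_ne_zero (by simp [Complex.cpow_eq_zero_iff, hm']) (div_ne_zero hf hm')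

theorem tendsto_normalizedPoch {s : ℂ} (hs : ∀ k : ℕ, s ≠ -(k : ℂ)) :
    Tendsto (normalizedPoch s) atTop (𝓝 (Complex.Gamma s)⁻¹) := by
  have h := (tendsto_natCast_div_add_atTop s).mul
    ((Complex.GammaSeq_tendsto_Gamma s).inv₀ (Complex.Gamma_ne_zero hs))
  rw [one_mul] at h
  refine h.congr fun m => ?_
  have hne : (m : ℂ) + s ≠ 0 := fun h => hs m (eq_neg_of_add_eq_zero_right h)
  have hp : ∏ j ∈ Finset.range (m + 1), (s + (j : ℂ)) = poch s m * (m + s) := by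
    rw [Finset.prod_range_succ, add_comm s (m : ℂ), poch]
  rw [Complex.GammaSeq, hp, normalizedPoch, inv_div, div_mul_div_comm, mul_comm (poch s m),
    mul_left_comm, mul_div_mul_left _ _ hne, ← mul_div_assoc, div_div_eq_mul_div,
    mul_comm (m : ℂ)]

theorem prod_poch_eq {n m : ℕ} (hm : m ≠ 0) (f : ℕ → ℂ) :
    ∏ i ∈ Finset.Icc 1 n, poch (f i) m = (∏ i ∈ Finset.Icc 1 n, normalizedPoch (f i) m) *
      ((m : ℂ) ^ (∑ i ∈ Finset.Icc 1 n, f i) * ((Nat.factorial m : ℂ) / m) ^ n) := by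
  have hm' : (m : ℂ) ≠ 0 := Nat.cast_ne_zero.2 hm
  have hsum : (m : ℂ) ^ (∑ i ∈ Finset.Icc 1 n, f i) = ∏ i ∈ Finset.Icc 1 n, (m : ℂ) ^ f i := by
    simp only [Complex.cpow_def_of_ne_zero hm', Finset.mul_sum, Complex.exp_sum]
  rw [Finset.prod_congr rfl fun i _ => poch_eq_normalizedPoch_mul (f i) hm,
    Finset.prod_mul_distrib, Finset.prod_mul_distrib, hsum, Finset.prod_const, Nat.card_Icc,
    Nat.add_sub_cancel]

/-- with `βₙ` defined by `α₁+⋯+αₙ = β₁+⋯+β_{n−1}+βₙ`, if none of the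
`β_j`, `α_i`, `βₙ` is a nonpositive integer, then
`(Γ(βₙ)Γ(m+1)/Γ(m+βₙ))·a_m → Γ(β₁)⋯Γ(β_{n−1})Γ(βₙ)/(Γ(α₁)⋯Γ(αₙ))` as `m → ∞`. -/
theorem gamma_normalized_coeff_limit (n : ℕ) (hn : 2 ≤ n) (α β : ℕ → ℂ) (βn : ℂ)
    (hβ : ∀ j ∈ Finset.Icc 1 (n - 1), ∀ k : ℕ, β j ≠ -(k : ℂ))
    (hα : ∀ i ∈ Finset.Icc 1 n, ∀ k : ℕ, α i ≠ -(k : ℂ))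
    (hβn : ∀ k : ℕ, βn ≠ -(k : ℂ))
    (hsum : ∑ i ∈ Finset.Icc 1 n, α i = (∑ j ∈ Finset.Icc 1 (n - 1), β j) + βn) :
    Filter.Tendsto
      (fun m : ℕ =>
        Complex.Gamma βn * Complex.Gamma ((m : ℂ) + 1) / Complex.Gamma ((m : ℂ) + βn)
          * aCoef n α β m)
      Filter.atTop
      (nhds ((∏ j ∈ Finset.Icc 1 (n - 1), Complex.Gamma (β j)) * Complex.Gamma βn /
        ∏ i ∈ Finset.Icc 1 n, Complex.Gamma (α i))) := by
  have hΓ := Complex.Gamma_ne_zero hβn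
  have hlimα := tendsto_finsetProd (Finset.Icc 1 n)
    fun i hi => tendsto_normalizedPoch (hα i hi)
  have hlimβ := (tendsto_finsetProd (Finset.Icc 1 (n - 1))
    fun j hj => tendsto_normalizedPoch (hβ j hj)).mul (tendsto_normalizedPoch hβn)
  have hne : (∏ j ∈ Finset.Icc 1 (n - 1), (Complex.Gamma (β j))⁻¹) * (Complex.Gamma βn)⁻¹ ≠ 0 :=
    mul_ne_zero
      (Finset.prod_ne_zero_iff.2 fun j hj => inv_ne_zero (Complex.Gamma_ne_zero (hβ j hj)))
      (inv_ne_zero hΓ)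
  have hlim := hlimα.div hlimβ hne
  rw [Finset.prod_inv_distrib, Finset.prod_inv_distrib, ← mul_inv, div_inv_eq_mul,
    inv_mul_eq_div] at hlim
  refine hlim.congr' ?_
  filter_upwards [eventually_ne_atTop 0] with m hm
  have hm' : (m : ℂ) ≠ 0 := Nat.cast_ne_zero.2 hm
  have hf : (Nat.factorial m : ℂ) ≠ 0 := Nat.cast_ne_zero.2 m.factorial_ne_zero
  set c := (m : ℂ) ^ (∑ i ∈ Finset.Icc 1 n, α i) * ((Nat.factorial m : ℂ) / m) ^ n with hc
  have hc0 : c ≠ 0 :=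
    mul_ne_zero (by simp [Complex.cpow_eq_zero_iff, hm']) (pow_ne_zero _ (div_ne_zero hf hm'))
  have hden : (∏ j ∈ Finset.Icc 1 (n - 1), poch (β j) m) * poch βn m =
      ((∏ j ∈ Finset.Icc 1 (n - 1), normalizedPoch (β j) m) * normalizedPoch βn m) * c := by
    rw [prod_poch_eq hm, poch_eq_normalizedPoch_mul βn hm, hc, hsum, Complex.cpow_add _ _ hm']
    conv_rhs => rw [← Nat.sub_add_cancel (show 1 ≤ n by omega), pow_succ, Nat.add_sub_cancel]
    ring
  calc _ = (∏ i ∈ Finset.Icc 1 n, poch (α i) m) /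
        ((∏ j ∈ Finset.Icc 1 (n - 1), poch (β j) m) * poch βn m) := by
        rw [hden, prod_poch_eq hm α, ← hc, mul_div_mul_right _ _ hc0]; rfl
    _ = _ := by
        have hp := poch_ne_zero hβn m
        rw [aCoef, Complex.Gamma_nat_eq_factorial, Gamma_add_natCast_eq_poch_mul hβn]
        field_simp
end

section
/- Assume the non-resonance condition. Then for every k with 1 ≤ k ≤ n−1, the function g(x) = x^{1−βₖ}·ₙF_{n−1}(𝛂ₖ;𝛃ₖ;x), defined on the real interval (0,1) with the principal branch of x^{1−βₖ}, satisfies the generalized hypergeometric equation (E) with parameters (𝛂₀;𝛃₀) on (0,1). -/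
open Finset

/-- The Euler operator `δ = x·d/dx` on complex-valued functions of a real variable. -/
noncomputable def deltaOp (y : ℝ → ℂ) : ℝ → ℂ := fun x => (x : ℂ) * deriv y x

/-- The operator `δ + γ`. -/
noncomputable def shiftOp (γ : ℂ) (y : ℝ → ℂ) : ℝ → ℂ := fun x => deltaOp y x + γ * y x

/-- Composition `(δ+c₁)∘(δ+c₂)∘⋯∘(δ+cₖ)` (first list entry outermost). -/
noncomputable def opProd : List ℂ → (ℝ → ℂ) → (ℝ → ℂ)
  | [], y => y
  | c :: cs, y => shiftOp c (opProd cs y)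

/-- `y` satisfies the generalized hypergeometric equation (E) with parameters `(𝛂;𝛃)`
on the real interval `(0,1)`:
`δ(δ+β₁−1)⋯(δ+β_{n−1}−1)y = x(δ+α₁)⋯(δ+αₙ)y`. -/
def SatE (n : ℕ) (α β : ℕ → ℂ) (y : ℝ → ℂ) : Prop :=
  ∀ x ∈ Set.Ioo (0:ℝ) 1,
    deltaOp (opProd ((List.range (n - 1)).map fun j => β (j + 1) - 1) y) x
      = (x : ℂ) * opProd ((List.range n).map fun i => α (i + 1)) y x

/-- Non-resonance: with `B j = β j` for `j < n` and `B n = βₙ`, no `B i` is an integer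
and no difference `B i − B j` (`i ≠ j`) is an integer, for `1 ≤ i, j ≤ n`. -/
def NonResonant (n : ℕ) (β : ℕ → ℂ) (βn : ℂ) : Prop :=
  ∀ i ∈ Finset.Icc 1 n, ∀ j ∈ Finset.Icc 1 n,
    ((∀ z : ℤ, (if i = n then βn else β i) ≠ (z : ℂ)) ∧
     (i ≠ j → ∀ z : ℤ, (if i = n then βn else β i) - (if j = n then βn else β j) ≠ (z : ℂ)))

/-- The coefficients `a` define a power series converging absolutely on the open unit disc. -/
def UnitDiscSummable (a : ℕ → ℂ) : Prop :=
  ∀ r : ℝ, 0 < r → r < 1 → Summable fun m => ‖a m‖ * r ^ m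

/-- The generalized power series `x ^ s * ∑ a m * x ^ m`. -/
noncomputable def frobeniusSeries (s : ℂ) (a : ℕ → ℂ) (x : ℝ) : ℂ :=
  (x : ℂ) ^ s * ∑' m : ℕ, a m * (x : ℂ) ^ m

namespace UnitDiscSummable

lemma natCast_mul {a : ℕ → ℂ} (ha : UnitDiscSummable a) :
    UnitDiscSummable fun m => (m : ℂ) * a m := by
  intro r hr hr1
  obtain ⟨q, hrq, hq1⟩ := exists_between hr1
  have hq : 0 < q := hr.trans hrq
  have hlim : Filter.Tendsto (fun m : ℕ => (m : ℝ) * (r / q) ^ m) Filter.atTop (nhds 0) :=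
    tendsto_self_mul_const_pow_of_lt_one (by positivity) ((div_lt_one hq).2 hrq)
  have hev : ∀ᶠ m : ℕ in Filter.atTop, (m : ℝ) * (r / q) ^ m ≤ 1 :=
    (hlim.eventually (gt_mem_nhds one_pos)).mono fun _ h => h.le
  refine Summable.of_norm_bounded_eventually_nat (ha q hq hq1) ?_
  filter_upwards [hev] with m hm
  have hrm : r ^ m = (r / q) ^ m * q ^ m := by
    rw [← mul_pow, div_mul_cancel₀ _ hq.ne']
  rw [Real.norm_of_nonneg (by positivity), norm_mul, Complex.norm_natCast, hrm]
  calc (m : ℝ) * ‖a m‖ * ((r / q) ^ m * q ^ m)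
      = (m * (r / q) ^ m) * (‖a m‖ * q ^ m) := by ring
    _ ≤ 1 * (‖a m‖ * q ^ m) := by gcongr
    _ = ‖a m‖ * q ^ m := one_mul _

lemma const_mul {a : ℕ → ℂ} (ha : UnitDiscSummable a) (c : ℂ) :
    UnitDiscSummable fun m => c * a m := by
  intro r hr hr1
  simpa only [norm_mul, mul_assoc] using (ha r hr hr1).mul_left ‖c‖

lemma add {a b : ℕ → ℂ} (ha : UnitDiscSummable a) (hb : UnitDiscSummable b) :
    UnitDiscSummable fun m => a m + b m := by
  intro r hr hr1
  refine Summable.of_nonneg_of_le (fun m => by positivity) (fun m => ?_)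
    ((ha r hr hr1).add (hb r hr hr1))
  rw [← add_mul]
  gcongr
  exact norm_add_le _ _

lemma linear_mul {a : ℕ → ℂ} (ha : UnitDiscSummable a) (c : ℂ) :
    UnitDiscSummable fun m => (c + m) * a m := by
  simpa only [add_mul] using (ha.const_mul c).add ha.natCast_mul

lemma summable {a : ℕ → ℂ} (ha : UnitDiscSummable a) {x : ℝ} (hx : x ∈ Set.Ioo (0 : ℝ) 1) :
    Summable fun m => a m * (x : ℂ) ^ m := by
  refine Summable.of_norm ?_
  simpa [abs_of_pos hx.1] using ha x hx.1 hx.2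

lemma hasDerivAt_tsum {a : ℕ → ℂ} (ha : UnitDiscSummable a) {x : ℝ}
    (hx : x ∈ Set.Ioo (0 : ℝ) 1) :
    HasDerivAt (fun z : ℂ => ∑' m : ℕ, a m * z ^ m)
      (∑' m : ℕ, a m * (m * (x : ℂ) ^ (m - 1))) (x : ℂ) := by
  obtain ⟨r, hxr, hr1⟩ := exists_between hx.2
  have hr : 0 < r := hx.1.trans hxr
  have hxmem : (x : ℂ) ∈ Metric.ball (0 : ℂ) r := by
    simpa [abs_of_pos hx.1] using hxr
  have hu : Summable fun m : ℕ => ‖a m‖ * (m * r ^ (m - 1)) := by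
    refine ((ha.natCast_mul r hr hr1).mul_left r⁻¹).congr fun m => ?_
    rcases m with _ | m
    · simp
    · rw [norm_mul, Complex.norm_natCast, Nat.add_sub_cancel, pow_succ]
      field_simp
  refine hasDerivAt_tsum_of_isPreconnected hu Metric.isOpen_ball
    (convex_ball (0 : ℂ) r).isPreconnected
    (fun m y _ => (hasDerivAt_pow m y).const_mul (a m)) (fun m y hy => ?_) hxmem
    (ha.summable hx) hxmem
  have hy' : ‖y‖ ≤ r := by simpa using (Metric.mem_ball.1 hy).le
  rw [norm_mul, norm_mul, norm_pow, Complex.norm_natCast]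
  gcongr

/-- The ratio test, for a coefficient sequence whose ratios `p m / q m` tend to `1`. -/
lemma of_ratio {a p q : ℕ → ℂ} (hq : ∀ m, q m ≠ 0) (hrec : ∀ m, q m * a (m + 1) = p m * a m)
    (hlim : Filter.Tendsto (fun m => p m / q m) Filter.atTop (nhds 1)) :
    UnitDiscSummable a := by
  intro r hr hr1
  obtain ⟨t, hrt, ht1⟩ := exists_between hr1
  have hlim' : Filter.Tendsto (fun m => ‖p m / q m‖ * r) Filter.atTop (nhds r) := by
    simpa using hlim.norm.mul_const r
  refine summable_of_ratio_norm_eventually_le ht1 ?_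
  filter_upwards [hlim'.eventually (gt_mem_nhds hrt)] with m hm
  have ham : a (m + 1) = p m / q m * a m := by
    rw [div_mul_eq_mul_div, eq_div_iff (hq m), ← hrec m, mul_comm]
  rw [Real.norm_of_nonneg (by positivity), Real.norm_of_nonneg (by positivity), ham, norm_mul]
  calc ‖p m / q m‖ * ‖a m‖ * r ^ (m + 1) = (‖p m / q m‖ * r) * (‖a m‖ * r ^ m) := by ring
    _ ≤ t * (‖a m‖ * r ^ m) := by gcongr

lemma deltaOp_frobeniusSeries {a : ℕ → ℂ} (ha : UnitDiscSummable a) (s : ℂ) :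
    Set.EqOn (deltaOp (frobeniusSeries s a)) (frobeniusSeries s fun m => (s + m) * a m)
      (Set.Ioo 0 1) := by
  intro x hx
  have hx0 : (x : ℂ) ≠ 0 := Complex.ofReal_ne_zero.2 hx.1.ne'
  have hd : HasDerivAt (frobeniusSeries s a) _ x :=
    (((hasDerivAt_id (x : ℂ)).cpow_const (c := s)
      (Complex.ofReal_mem_slitPlane.2 hx.1)).mul (ha.hasDerivAt_tsum hx)).comp_ofReal
  have hmul : (x : ℂ) * ∑' m : ℕ, a m * (m * (x : ℂ) ^ (m - 1))
      = ∑' m : ℕ, (m * a m) * (x : ℂ) ^ m := by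
    rw [← tsum_mul_left]
    refine tsum_congr fun m => ?_
    rcases m with _ | m
    · simp
    · rw [Nat.add_sub_cancel, pow_succ]
      ring
  have hsplit : ∑' m : ℕ, ((s + m) * a m) * (x : ℂ) ^ m
      = s * ∑' m : ℕ, a m * (x : ℂ) ^ m + ∑' m : ℕ, (m * a m) * (x : ℂ) ^ m := by
    rw [← tsum_mul_left,
      ← ((ha.summable hx).mul_left s).tsum_add (ha.natCast_mul.summable hx)]
    exact tsum_congr fun m => by ring
  have hpow : (x : ℂ) * (x : ℂ) ^ (s - 1) = (x : ℂ) ^ s := by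
    rw [Complex.cpow_sub _ _ hx0, Complex.cpow_one, mul_div_cancel₀ _ hx0]
  rw [deltaOp, hd.deriv, frobeniusSeries, hsplit, ← hmul]
  simp only [id, mul_one]
  rw [← hpow]
  ring

lemma shiftOp_frobeniusSeries {a : ℕ → ℂ} (ha : UnitDiscSummable a) (s c : ℂ) :
    Set.EqOn (shiftOp c (frobeniusSeries s a)) (frobeniusSeries s fun m => (s + m + c) * a m)
      (Set.Ioo 0 1) := by
  intro x hx
  have hsplit : ∑' m : ℕ, ((s + m + c) * a m) * (x : ℂ) ^ m
      = ∑' m : ℕ, ((s + m) * a m) * (x : ℂ) ^ m + c * ∑' m : ℕ, a m * (x : ℂ) ^ m := by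
    rw [← tsum_mul_left,
      ← ((ha.linear_mul s).summable hx).tsum_add ((ha.summable hx).mul_left c)]
    exact tsum_congr fun m => by ring
  rw [shiftOp, ha.deltaOp_frobeniusSeries s hx]
  simp only [frobeniusSeries, hsplit]
  ring

lemma list_prod_mul {a : ℕ → ℂ} (ha : UnitDiscSummable a) (s : ℂ) (L : List ℂ) :
    UnitDiscSummable fun m => (L.map fun c => s + m + c).prod * a m := by
  induction L with
  | nil => simpa using ha
  | cons c L ih =>
    simpa only [List.map_cons, List.prod_cons, mul_assoc, add_right_comm] using
      ih.linear_mul (s + c)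

end UnitDiscSummable

lemma deltaOp_eqOn {f g : ℝ → ℂ} {U : Set ℝ} (hU : IsOpen U) (h : Set.EqOn f g U) :
    Set.EqOn (deltaOp f) (deltaOp g) U := by
  intro x hx
  rw [deltaOp, deltaOp, (h.eventuallyEq_of_mem (hU.mem_nhds hx)).deriv_eq]

lemma UnitDiscSummable.opProd_frobeniusSeries {a : ℕ → ℂ} (ha : UnitDiscSummable a) (s : ℂ)
    (L : List ℂ) :
    Set.EqOn (opProd L (frobeniusSeries s a))
      (frobeniusSeries s fun m => (L.map fun c => s + m + c).prod * a m) (Set.Ioo 0 1) := by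
  induction L with
  | nil => intro x _; simp [opProd]
  | cons c L ih =>
    intro x hx
    rw [opProd, shiftOp, deltaOp_eqOn isOpen_Ioo ih hx, ih hx]
    have h := (ha.list_prod_mul s L).shiftOp_frobeniusSeries s c hx
    rw [shiftOp] at h
    rw [h]
    simp only [List.map_cons, List.prod_cons, mul_assoc]

lemma poch_succ (a : ℂ) (m : ℕ) : poch a (m + 1) = poch a m * (a + m) :=
  Finset.prod_range_succ _ _

lemma poch_ne_zero_s15 {a : ℂ} (h : ∀ m : ℕ, a + m ≠ 0) (m : ℕ) : poch a m ≠ 0 :=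
  Finset.prod_ne_zero_iff.2 fun s _ => h s

lemma aCoef_succ (n : ℕ) (α β : ℕ → ℂ)
    (hβ : ∀ j ∈ Finset.Icc 1 (n - 1), ∀ m : ℕ, β j + m ≠ 0) (m : ℕ) :
    (∏ j ∈ Finset.Icc 1 (n - 1), (β j + m)) * (m + 1) * aCoef n α β (m + 1)
      = (∏ i ∈ Finset.Icc 1 n, (α i + m)) * aCoef n α β m := by
  have h1 : ∏ j ∈ Finset.Icc 1 (n - 1), (β j + m) ≠ 0 :=
    Finset.prod_ne_zero_iff.2 fun j hj => hβ j hj m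
  have h2 : ∏ j ∈ Finset.Icc 1 (n - 1), poch (β j) m ≠ 0 :=
    Finset.prod_ne_zero_iff.2 fun j hj => poch_ne_zero_s15 (hβ j hj) m
  have h3 : (m : ℂ) + 1 ≠ 0 := Nat.cast_add_one_ne_zero m
  have h4 : (Nat.factorial m : ℂ) ≠ 0 := Nat.cast_ne_zero.2 m.factorial_ne_zero
  simp only [aCoef, poch_succ, Finset.prod_mul_distrib, Nat.factorial_succ, Nat.cast_mul,
    Nat.cast_add, Nat.cast_one]
  field_simp

lemma tendsto_natCast_add_div_natCast_add_one (c : ℂ) :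
    Filter.Tendsto (fun m : ℕ => (c + m) / ((m : ℂ) + 1)) Filter.atTop (nhds 1) := by
  have h : Filter.Tendsto (fun m : ℕ => (c - 1) * (1 / ((m : ℂ) + 1)) + 1) Filter.atTop
      (nhds 1) := by
    simpa using ((tendsto_one_div_add_atTop_nhds_zero_nat (𝕜 := ℂ)).const_mul (c - 1)).add_const 1
  refine h.congr fun m => ?_
  have : (m : ℂ) + 1 ≠ 0 := Nat.cast_add_one_ne_zero m
  field_simp
  ring

lemma unitDiscSummable_aCoef {n : ℕ} (hn : 1 ≤ n) (α β : ℕ → ℂ)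
    (hβ : ∀ j ∈ Finset.Icc 1 (n - 1), ∀ m : ℕ, β j + m ≠ 0) :
    UnitDiscSummable (aCoef n α β) := by
  refine UnitDiscSummable.of_ratio (fun m => mul_ne_zero
    (Finset.prod_ne_zero_iff.2 fun j hj => hβ j hj m) (Nat.cast_add_one_ne_zero m))
    (aCoef_succ n α β hβ) ?_
  have hα := tendsto_finsetProd (Finset.Icc 1 n)
    fun i _ => tendsto_natCast_add_div_natCast_add_one (α i)
  have hβ' := tendsto_finsetProd (Finset.Icc 1 (n - 1))
    fun j _ => tendsto_natCast_add_div_natCast_add_one (β j)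
  have h := hα.div hβ' (by simp)
  simp only [Finset.prod_const_one, div_one] at h
  refine h.congr fun m => ?_
  have hm : (m : ℂ) + 1 ≠ 0 := Nat.cast_add_one_ne_zero m
  have hprod : ∏ j ∈ Finset.Icc 1 (n - 1), (β j + m) ≠ 0 :=
    Finset.prod_ne_zero_iff.2 fun j hj => hβ j hj m
  obtain ⟨n, rfl⟩ := Nat.exists_eq_add_of_le' hn
  simp only [Pi.div_apply, Finset.prod_div_distrib, Finset.prod_const, Nat.card_Icc,
    Nat.add_sub_cancel] at hprod ⊢
  field_simp
  ring

lemma list_map_range_prod (n : ℕ) (f : ℕ → ℂ) :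
    ((List.range n).map fun i => f (i + 1)).prod = ∏ i ∈ Finset.Icc 1 n, f i := by
  induction n with
  | zero => simp
  | succ n ih => rw [List.prod_range_succ, ih, Finset.prod_Icc_succ_top (by omega)]

/-- A coefficient recursion with vanishing indicial polynomial gives a solution of the
hypergeometric equation. -/
lemma satE_frobeniusSeries {n : ℕ} {α β : ℕ → ℂ} {s : ℂ} {a : ℕ → ℂ}
    (ha : UnitDiscSummable a)
    (h0 : ∏ j ∈ Finset.Icc 1 (n - 1), (s + (β j - 1)) = 0)
    (hrec : ∀ m : ℕ, (s + m + 1) * (∏ j ∈ Finset.Icc 1 (n - 1), (s + m + β j)) * a (m + 1)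
      = (∏ i ∈ Finset.Icc 1 n, (s + m + α i)) * a m) :
    SatE n α β (frobeniusSeries s a) := by
  intro x hx
  set L := (List.range (n - 1)).map fun j => β (j + 1) - 1
  have hL := ha.list_prod_mul s L
  rw [deltaOp_eqOn isOpen_Ioo (ha.opProd_frobeniusSeries s L) hx,
    hL.deltaOp_frobeniusSeries s hx, ha.opProd_frobeniusSeries s _ hx]
  have hprod (m : ℕ) : (L.map fun c => s + m + c).prod
      = ∏ j ∈ Finset.Icc 1 (n - 1), (s + m + (β j - 1)) := by
    rw [List.map_map]
    exact list_map_range_prod (n - 1) fun j => s + m + (β j - 1)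
  simp only [frobeniusSeries]
  rw [((hL.linear_mul s).summable hx).tsum_eq_zero_add, mul_left_comm (x : ℂ), ← tsum_mul_left]
  refine congrArg _ ?_
  rw [hprod 0, Nat.cast_zero, add_zero, h0]
  simp only [zero_mul, mul_zero, zero_add]
  refine tsum_congr fun m => ?_
  rw [hprod, List.map_map]
  have hα : ((List.range n).map ((fun c => s + (m : ℂ) + c) ∘ fun i => α (i + 1))).prod
      = ∏ i ∈ Finset.Icc 1 n, (s + m + α i) := list_map_range_prod n fun i => s + m + α i
  have hβ : ∏ j ∈ Finset.Icc 1 (n - 1), (s + ((m + 1 : ℕ) : ℂ) + (β j - 1))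
      = ∏ j ∈ Finset.Icc 1 (n - 1), (s + m + β j) :=
    Finset.prod_congr rfl fun j _ => by push_cast; ring
  rw [hα, ← hrec m, hβ, pow_succ]
  push_cast
  ring

/-- under non-resonance, for `1 ≤ k ≤ n−1` the function
`g(x) = x^{1−βₖ}·ₙF_{n−1}(𝛂ₖ;𝛃ₖ;x)` on `(0,1)` satisfies (E) with parameters `(𝛂₀;𝛃₀)`. -/
theorem shifted_solution_solves_equation (n : ℕ) (hn : 2 ≤ n) (α β : ℕ → ℂ) (βn : ℂ)
    (hsum : ∑ i ∈ Finset.Icc 1 n, α i = (∑ j ∈ Finset.Icc 1 (n - 1), β j) + βn)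
    (hnr : NonResonant n β βn) :
    ∀ k : ℕ, 1 ≤ k → k ≤ n - 1 →
      SatE n α β
        (fun x : ℝ => (x : ℂ) ^ (1 - β k) *
          ∑' m : ℕ, aCoef n (fun i => α i + 1 - β k)
            (fun j => if j = k then 2 - β k else β j + 1 - β k) m * (x : ℂ) ^ m) := by
  intro k hk1 hkn
  have hk : k ∈ Finset.Icc 1 (n - 1) := Finset.mem_Icc.2 ⟨hk1, hkn⟩
  have hmem : ∀ j ∈ Finset.Icc 1 (n - 1), j ∈ Finset.Icc 1 n ∧ j ≠ n := by
    intro j hj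
    rw [Finset.mem_Icc] at hj ⊢
    omega
  have hden : ∀ j ∈ Finset.Icc 1 (n - 1), ∀ m : ℕ,
      (if j = k then 2 - β k else β j + 1 - β k) + (m : ℂ) ≠ 0 := by
    intro j hj m h
    obtain ⟨hjn, hjne⟩ := hmem j hj
    obtain ⟨hkn', hkne⟩ := hmem k hk
    obtain ⟨hint, hdiff⟩ := hnr k hkn' j hjn
    simp only [if_neg hjne, if_neg hkne] at hint hdiff
    split_ifs at h with hjk
    · refine hint (2 + m) ?_
      push_cast
      linear_combination -h
    · refine hdiff (Ne.symm hjk) (1 + m) ?_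
      push_cast
      linear_combination -h
  refine satE_frobeniusSeries (unitDiscSummable_aCoef (by omega) _ _ hden)
    (Finset.prod_eq_zero hk (by ring)) fun m => ?_
  have hnum : ∏ i ∈ Finset.Icc 1 n, (1 - β k + m + α i)
      = ∏ i ∈ Finset.Icc 1 n, (α i + 1 - β k + m) := Finset.prod_congr rfl fun i _ => by ring
  rw [hnum, ← aCoef_succ n _ _ hden m, ← Finset.mul_prod_erase _ _ hk,
    ← Finset.mul_prod_erase _ (fun j => (if j = k then 2 - β k else β j + 1 - β k) + (m : ℂ)) hk]
  have herase : ∏ j ∈ (Finset.Icc 1 (n - 1)).erase k,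
        ((if j = k then 2 - β k else β j + 1 - β k) + (m : ℂ))
      = ∏ j ∈ (Finset.Icc 1 (n - 1)).erase k, (1 - β k + m + β j) :=
    Finset.prod_congr rfl fun j hj => by
      rw [if_neg (Finset.ne_of_mem_erase hj)]
      ring
  rw [herase, if_pos rfl]
  ring
end

section
/- Assume the non-resonance condition. Fix k with 1 ≤ k ≤ n−1 and let y be a smooth complex-valued function on the real interval (0,1). Then y satisfies the generalized hypergeometric equation (E) with shifted parameters (𝛂ₖ;𝛃ₖ) on (0,1) if and only if the function x ↦ x^{1−βₖ}·y(x) (principal branch of x^{1−βₖ} on (0,1)) satisfies (E) with parameters (𝛂₀;𝛃₀) on (0,1). -/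
open Finset

theorem ContDiffOn.deltaOp {y : ℝ → ℂ} {s : Set ℝ} (hs : IsOpen s)
    (hy : ContDiffOn ℝ (⊤ : ℕ∞) y s) : ContDiffOn ℝ (⊤ : ℕ∞) (deltaOp y) s :=
  Complex.ofRealCLM.contDiff.contDiffOn.mul (hy.deriv_of_isOpen hs (by simp))

theorem ContDiffOn.shiftOp {y : ℝ → ℂ} {s : Set ℝ} (hs : IsOpen s) (c : ℂ)
    (hy : ContDiffOn ℝ (⊤ : ℕ∞) y s) : ContDiffOn ℝ (⊤ : ℕ∞) (shiftOp c y) s :=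
  (hy.deltaOp hs).add (contDiffOn_const.mul hy)

theorem ContDiffOn.opProd {y : ℝ → ℂ} {s : Set ℝ} (hs : IsOpen s) (L : List ℂ)
    (hy : ContDiffOn ℝ (⊤ : ℕ∞) y s) : ContDiffOn ℝ (⊤ : ℕ∞) (opProd L y) s := by
  induction L with
  | nil => exact hy
  | cons c cs ih => exact ih.shiftOp hs c

theorem Set.EqOn.shiftOp {f g : ℝ → ℂ} {s : Set ℝ} (hs : IsOpen s) (c : ℂ)
    (h : Set.EqOn f g s) : Set.EqOn (shiftOp c f) (shiftOp c g) s := fun x hx => by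
  have := (h.eventuallyEq_of_mem (hs.mem_nhds hx)).deriv_eq
  simp only [_root_.shiftOp, deltaOp, this, h hx]

theorem ContDiffOn.differentiableAt_of_isOpen {y : ℝ → ℂ} {s : Set ℝ} (hs : IsOpen s)
    (hy : ContDiffOn ℝ (⊤ : ℕ∞) y s) {x : ℝ} (hx : x ∈ s) : DifferentiableAt ℝ y x :=
  (hy.differentiableOn (by simp)).differentiableAt (hs.mem_nhds hx)

theorem deltaOp_shiftOp {y : ℝ → ℂ} {s : Set ℝ} (hs : IsOpen s) (c : ℂ)
    (hy : ContDiffOn ℝ (⊤ : ℕ∞) y s) {x : ℝ} (hx : x ∈ s) :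
    deltaOp (shiftOp c y) x = deltaOp (deltaOp y) x + c * deltaOp y x := by
  have h₁ := (hy.deltaOp hs).differentiableAt_of_isOpen hs hx
  have h₂ := hy.differentiableAt_of_isOpen hs hx
  have h : deriv (shiftOp c y) x = deriv (deltaOp y) x + c * deriv y x :=
    (h₁.hasDerivAt.add (h₂.hasDerivAt.const_mul c)).deriv
  rw [deltaOp, h]
  simp only [deltaOp]
  ring

theorem shiftOp_comm {y : ℝ → ℂ} {s : Set ℝ} (hs : IsOpen s) (a b : ℂ)
    (hy : ContDiffOn ℝ (⊤ : ℕ∞) y s) :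
    Set.EqOn (shiftOp a (shiftOp b y)) (shiftOp b (shiftOp a y)) s := fun x hx => by
  rw [shiftOp, deltaOp_shiftOp hs b hy hx, shiftOp, shiftOp, deltaOp_shiftOp hs a hy hx, shiftOp]
  ring

theorem List.Perm.eqOn_opProd {y : ℝ → ℂ} {s : Set ℝ} (hs : IsOpen s)
    (hy : ContDiffOn ℝ (⊤ : ℕ∞) y s) {L M : List ℂ} (h : L.Perm M) :
    Set.EqOn (opProd L y) (opProd M y) s := by
  induction h with
  | nil => exact fun _ _ => rfl
  | cons c _ ih => exact ih.shiftOp hs c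
  | swap a b l => exact shiftOp_comm hs b a (hy.opProd hs l)
  | trans _ _ ih₁ ih₂ => exact ih₁.trans ih₂

theorem hasDerivAt_ofReal_cpow {x : ℝ} (hx : 0 < x) (c : ℂ) :
    HasDerivAt (fun t : ℝ => (t : ℂ) ^ c) (c * (x : ℂ) ^ (c - 1)) x := by
  have h := (hasDerivAt_id (x : ℂ)).cpow_const (c := c) (Complex.ofReal_mem_slitPlane.2 hx)
  simpa using h.comp_ofReal

theorem shiftOp_cpow_mul {f : ℝ → ℂ} {x : ℝ} (hx : 0 < x) (hf : DifferentiableAt ℝ f x)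
    (a c : ℂ) : shiftOp a (fun t : ℝ => (t : ℂ) ^ c * f t) x = (x : ℂ) ^ c * shiftOp (a + c) f x := by
  have hx' : (x : ℂ) ≠ 0 := Complex.ofReal_ne_zero.2 hx.ne'
  have h : deriv (fun t : ℝ => (t : ℂ) ^ c * f t) x =
      c * (x : ℂ) ^ (c - 1) * f x + (x : ℂ) ^ c * deriv f x :=
    ((hasDerivAt_ofReal_cpow hx c).mul hf.hasDerivAt).deriv
  simp only [shiftOp, deltaOp]
  rw [h, Complex.cpow_sub _ _ hx', Complex.cpow_one]
  field_simp
  ring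

/-- Conjugating a product of shifted Euler operators by `x ^ c` adds `c` to every shift. -/
theorem opProd_cpow_mul {y : ℝ → ℂ} {s : Set ℝ} (hs : IsOpen s) (hpos : ∀ x ∈ s, 0 < x)
    (hy : ContDiffOn ℝ (⊤ : ℕ∞) y s) (c : ℂ) (L : List ℂ) :
    Set.EqOn (opProd L fun t : ℝ => (t : ℂ) ^ c * y t)
      (fun t : ℝ => (t : ℂ) ^ c * opProd (L.map (· + c)) y t) s := by
  induction L with
  | nil => exact fun _ _ => rfl
  | cons a L ih =>
    intro x hx
    exact (ih.shiftOp hs a hx).trans (shiftOp_cpow_mul (hpos x hx)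
      ((hy.opProd hs _).differentiableAt_of_isOpen hs hx) a c)

theorem deltaOp_opProd (L : List ℂ) (y : ℝ → ℂ) : deltaOp (opProd L y) = opProd (0 :: L) y := by
  funext x
  simp [opProd, shiftOp]

theorem shifted_exponents_perm {m k : ℕ} (hk1 : 1 ≤ k) (hk2 : k ≤ m) (β : ℕ → ℂ) :
    (0 :: (List.range m).map fun j =>
        (if j + 1 = k then 2 - β k else β (j + 1) + 1 - β k) - 1).Perm
      ((0 :: (List.range m).map fun j => β (j + 1) - 1).map (· + (1 - β k))) := by
  obtain ⟨k, rfl⟩ := Nat.exists_eq_add_of_le' hk1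
  have hr : (List.range m).Perm (k :: (List.range m).erase k) :=
    List.perm_cons_erase (List.mem_range.2 hk2)
  have hM : ((List.range m).erase k).map (fun j =>
        (if j + 1 = k + 1 then 2 - β (k + 1) else β (j + 1) + 1 - β (k + 1)) - 1) =
      ((List.range m).erase k).map (fun j => β (j + 1) - 1 + (1 - β (k + 1))) := by
    refine List.map_congr_left fun j hj => ?_
    have hjk : j ≠ k := (List.nodup_range.mem_erase_iff.1 hj).1
    rw [if_neg (by omega)]
    ring
  refine ((hr.map _).cons 0).trans (List.Perm.trans ?_ (((hr.map _).cons 0).map _).symm)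
  simp only [List.map_cons, List.map_map, Function.comp_def, hM, if_true]
  rw [show (2 - β (k + 1) - 1 : ℂ) = 0 + (1 - β (k + 1)) by ring,
    show β (k + 1) - 1 + (1 - β (k + 1)) = 0 by ring]
  exact List.Perm.swap _ _ _

/-- under non-resonance, for `1 ≤ k ≤ n−1` and `y` smooth on `(0,1)`,
`y` satisfies (E) with the shifted parameters `(𝛂ₖ;𝛃ₖ)` iff `x ↦ x^{1−βₖ}·y(x)`
satisfies (E) with parameters `(𝛂₀;𝛃₀)` on `(0,1)`. -/
theorem shift_equivalence (n : ℕ) (hn : 2 ≤ n) (α β : ℕ → ℂ) (βn : ℂ)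
    (hsum : ∑ i ∈ Finset.Icc 1 n, α i = (∑ j ∈ Finset.Icc 1 (n - 1), β j) + βn)
    (hnr : NonResonant n β βn)
    (k : ℕ) (hk1 : 1 ≤ k) (hk2 : k ≤ n - 1)
    (y : ℝ → ℂ) (hy : ContDiffOn ℝ (⊤ : ℕ∞) y (Set.Ioo (0:ℝ) 1)) :
    SatE n (fun i => α i + 1 - β k)
        (fun j => if j = k then 2 - β k else β j + 1 - β k) y ↔
      SatE n α β (fun x : ℝ => (x : ℂ) ^ (1 - β k) * y x) := by
  have hs : IsOpen (Set.Ioo (0 : ℝ) 1) := isOpen_Ioo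
  have hpos : ∀ x ∈ Set.Ioo (0 : ℝ) 1, 0 < x := fun x hx => hx.1
  refine forall₂_congr fun x hx => ?_
  have hxc : (x : ℂ) ^ (1 - β k) ≠ 0 := by
    simp [Complex.cpow_eq_zero_iff, hx.1.ne']
  have hα : ((List.range n).map fun i => α (i + 1)).map (· + (1 - β k)) =
      (List.range n).map fun i => α (i + 1) + 1 - β k := by
    simp [Function.comp_def, add_sub_assoc]
  rw [deltaOp_opProd, deltaOp_opProd, opProd_cpow_mul hs hpos hy _ _ hx,
    opProd_cpow_mul hs hpos hy _ _ hx, hα,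
    (shifted_exponents_perm hk1 hk2 β).eqOn_opProd hs hy hx, mul_left_comm]
  exact (mul_right_inj' hxc).symm
end
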